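/- For all additive commutative groups A and B, the map sending a group homomorphism f : A → B to the natural transformation Â ⟶ B̂ whose component in degree n is postcomposition with f is a bijection from the set of group homomorphisms A → B onto the set of natural transformations Â ⟶ B̂; its inverse sends a natural transformation u to its component u₁ : (Fin 1 → A) → (Fin 1 → B) evaluated in degree 1 (identified with a map A → B). -/

import Mathlib

open CategoryTheory Limits

/-- The category `𝕋`: objects are natural numbers, morphisms `n ⟶ k` are `k × n`
integer matrices, composition is matrix multiplication. -/
instance : Category ℕ where
  Hom n k := Matrix (Fin k) (Fin n) ℤ
  id n := (1 : Matrix (Fin n) (Fin n) ℤ)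
  comp {n k m} P Q :=
    show Matrix (Fin m) (Fin n) ℤ from
      (show Matrix (Fin m) (Fin k) ℤ from Q) * (show Matrix (Fin k) (Fin n) ℤ from P)
  id_comp := by intros; exact Matrix.mul_one _
  comp_id := by intros; exact Matrix.one_mul _
  assoc := by intros; exact (Matrix.mul_assoc _ _ _).symm

/-- The block matrix `(I_n | 0) : (n+m) ⟶ n`. -/
def proj₁ (n m : ℕ) : Matrix (Fin n) (Fin (n + m)) ℤ :=
  fun i j => if (j : ℕ) = (i : ℕ) then 1 else 0

/-- The block matrix `(0 | I_m) : (n+m) ⟶ m`. -/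
def proj₂ (n m : ℕ) : Matrix (Fin m) (Fin (n + m)) ℤ :=
  fun i j => if (j : ℕ) = n + (i : ℕ) then 1 else 0

/-- The functor `Ĝ : 𝕋 ⥤ Type` associated to an additive commutative group `G`:
`n ↦ (Fin n → G)` on objects, integer matrices acting by `(P · x) i = ∑ j, P i j • x j`. -/
def hatF (G : Type) [AddCommGroup G] : ℕ ⥤ Type where
  obj n := Fin n → G
  map {n k} P := ↾fun x i => ∑ j, (show Matrix (Fin k) (Fin n) ℤ from P) i j • x j
  map_id := by
    intro n
    apply ConcreteCategory.hom_ext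
    intro x
    funext i
    show ∑ j, (1 : Matrix (Fin n) (Fin n) ℤ) i j • x j = x i
    simp [Matrix.one_apply]
  map_comp := by
    intro n k m P Q
    apply ConcreteCategory.hom_ext
    intro x
    funext i
    show ∑ j, ((show Matrix (Fin m) (Fin k) ℤ from Q) *
        (show Matrix (Fin k) (Fin n) ℤ from P)) i j • x j =
      ∑ l, (show Matrix (Fin m) (Fin k) ℤ from Q) i l •
        ∑ j, (show Matrix (Fin k) (Fin n) ℤ from P) l j • x j
    simp only [Matrix.mul_apply, Finset.sum_smul, Finset.smul_sum, mul_smul]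
    exact Finset.sum_comm

/-- The natural transformation `Â ⟶ B̂` induced by a homomorphism `f : A →+ B`:
in each degree `n` it is postcomposition with `f`. -/
def hatNat {A B : Type} [AddCommGroup A] [AddCommGroup B] (f : A →+ B) :
    hatF A ⟶ hatF B where
  app n := ↾fun x => f ∘ x
  naturality := by
    intro n k P
    apply ConcreteCategory.hom_ext
    intro x
    funext i
    show f (∑ j, _ • x j) = ∑ j, _ • f (x j)
    simp [map_sum, map_zsmul]

/-- The component of `u` in degree `n`, as a plain function. -/
def hatApp {A B : Type} [AddCommGroup A] [AddCommGroup B]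
    (u : hatF A ⟶ hatF B) (n : ℕ) (x : Fin n → A) : Fin n → B := u.app n x

theorem hat_nat_apply {A B : Type} [AddCommGroup A] [AddCommGroup B]
    (u : hatF A ⟶ hatF B) {n k : ℕ} (P : Matrix (Fin k) (Fin n) ℤ) (x : Fin n → A) :
    hatApp u k (fun i => ∑ j, P i j • x j) = fun i => ∑ j, P i j • hatApp u n x j :=
  ConcreteCategory.congr_hom (u.naturality (X := n) (Y := k) P) x

/-- Component `i` of `u.app n x` is `u.app 1` applied to `x i`. -/
theorem hat_app_coord {A B : Type} [AddCommGroup A] [AddCommGroup B]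
    (u : hatF A ⟶ hatF B) {n : ℕ} (x : Fin n → A) (i : Fin n) :
    hatApp u n x i = hatApp u 1 (fun _ => x i) 0 := by
  have h := congrFun (hat_nat_apply u
    (fun (_ : Fin 1) (j : Fin n) => if i = j then (1 : ℤ) else 0) x) 0
  simp only [ite_smul, one_smul, zero_smul, Finset.sum_ite_eq, Finset.mem_univ, if_true] at h
  exact h.symm

theorem hat_app_add {A B : Type} [AddCommGroup A] [AddCommGroup B]
    (u : hatF A ⟶ hatF B) (a b : A) :
    hatApp u 1 (fun _ => a + b) 0 = hatApp u 1 (fun _ => a) 0 + hatApp u 1 (fun _ => b) 0 := by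
  have h := congrFun (hat_nat_apply u
    (fun (_ : Fin 1) (_ : Fin 2) => (1 : ℤ)) ![a, b]) 0
  simp only [one_smul, Fin.sum_univ_two] at h
  rw [hat_app_coord u ![a, b] 0, hat_app_coord u ![a, b] 1] at h
  exact h

/-- The map `f ↦ hatNat f`, sending a group homomorphism `A →+ B` to the natural
transformation `Â ⟶ B̂` given by postcomposition with `f` in each degree, is a
bijection from group homomorphisms onto natural transformations `Â ⟶ B̂`; its
inverse sends a natural transformation `u` to its component `u.app 1` in degree `1`,
identified with a map `A → B`. -/
theorem hom_equiv_natTrans (A B : Type) [AddCommGroup A] [AddCommGroup B] :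
    ∃ e : (A →+ B) ≃ (hatF A ⟶ hatF B),
      (∀ f : A →+ B, e f = hatNat f) ∧
      (∀ (u : hatF A ⟶ hatF B) (a : A), (e.symm u) a = u.app 1 (fun _ => a) 0) := by
  refine ⟨{ toFun := hatNat
            invFun := fun u => AddMonoidHom.mk'
              (fun a => hatApp u 1 (fun _ => a) 0) (hat_app_add u)
            left_inv := ?_
            right_inv := ?_ }, fun _ => rfl, fun _ _ => rfl⟩
  · intro f
    ext a
    rfl
  · intro u
    apply NatTrans.ext
    funext n
    apply ConcreteCategory.hom_ext
    intro x
    funext i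
    exact (hat_app_coord u x i).symm
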